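/- arXiv:1209.5169 — 2 statements merged into one kernel-verified Lean document; each statement's English description precedes it below -/
import Mathlib

section
/- Let G be a primitive permutation group of finite degree n that contains a cycle of prime length fixing at least three points. Then G contains the alternating group A_n. -/
/-- `G` acts preprimitively on `α`: the action is pretransitive and every block is trivial. -/
def IsPreprimitive (G : Type*) (α : Type*) [Group G] [MulAction G α] : Prop :=
  MulAction.IsPretransitive G α ∧
    ∀ B : Set α, MulAction.IsBlock G B → MulAction.IsTrivialBlock B

theorem jpc_sylow {H : Type*} [Group H] [Finite H] {p : ℕ} (hp : p.Prime)
    (hcard : (Nat.card H).factorization p = 1) (g₁ g₂ : H)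
    (h₁ : orderOf g₁ = p) (h₂ : orderOf g₂ = p) :
    ∃ (u : H) (i : ℤ), u * g₂ * u⁻¹ = g₁ ^ i := by
  have : Fact p.Prime := ⟨hp⟩
  let P : Sylow p H := Sylow.ofCard (Subgroup.zpowers g₁) (by
    rw [Nat.card_zpowers, h₁, hcard, pow_one])
  let Q : Sylow p H := Sylow.ofCard (Subgroup.zpowers g₂) (by
    rw [Nat.card_zpowers, h₂, hcard, pow_one])
  obtain ⟨u, hu⟩ := MulAction.exists_smul_eq H Q P
  have h : u * g₂ * u⁻¹ ∈ (P : Subgroup H) := by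
    rw [← hu, Sylow.coe_subgroup_smul]
    have hm : g₂ ∈ (Q : Subgroup H) := Subgroup.mem_zpowers g₂
    have := Subgroup.smul_mem_pointwise_smul g₂ (MulAut.conj u) _ hm
    simpa using this
  obtain ⟨i, hi⟩ := Subgroup.mem_zpowers_iff.1 (show _ ∈ Subgroup.zpowers g₁ from h)
  exact ⟨u, i, hi.symm⟩

theorem jpc_normalizing {Ω : Type*} [Fintype Ω] [DecidableEq Ω]
    (G : Subgroup (Equiv.Perm Ω)) (g : Equiv.Perm Ω) (hg : g ∈ G) (hc : g.IsCycle)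
    (hp : Nat.Prime g.support.card) (h : Equiv.Perm Ω) (hh : h ∈ G)
    (hΓ : ∀ a, g a = a → g (h a) = h a) :
    ∃ x ∈ G, (∀ a, g a = a → x a = h a) ∧ ∃ i : ℤ, x * g * x⁻¹ = g ^ i := by
  set p := g.support.card with hpdef
  have hΓ' : ∀ a, g a = a → g (h⁻¹ a) = h⁻¹ a := by
    intro a ha
    have hmaps : Set.MapsTo h {a | g a = a} {a | g a = a} := fun a ha => hΓ a ha
    have hs : Set.SurjOn h {a | g a = a} {a | g a = a} :=
      ((Set.toFinite _).injOn_iff_bijOn_of_mapsTo hmaps |>.1 h.injective.injOn).surjOn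
    obtain ⟨b, hb, hba⟩ := hs ha
    have : h⁻¹ a = b := by rw [← hba]; simp
    rw [this]; exact hb
  let K : Subgroup (Equiv.Perm Ω) :=
    { carrier := {f | ∀ a, g a = a → f a = a}
      mul_mem' := by
        intro f f' hf hf' a ha
        simp [hf' a ha, hf a ha]
      one_mem' := by intro a _; rfl
      inv_mem' := by
        intro f hf a ha
        rw [Equiv.Perm.inv_eq_iff_eq]; exact (hf a ha).symm }
  have hKcard : Nat.card K = p.factorial := by
    have e : Equiv.Perm {a // a ∈ g.support} ≃ K :=
      (Equiv.Perm.subtypeEquivSubtypePerm (fun a => a ∈ g.support)).trans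
        (Equiv.subtypeEquivRight (by
          intro f
          change _ ↔ ∀ a, g a = a → f a = a
          simp [Equiv.Perm.mem_support]))
    rw [← Nat.card_congr e, Nat.card_perm, Nat.card_eq_fintype_card, Fintype.card_coe]
  let H : Subgroup (Equiv.Perm Ω) := K ⊓ G
  have hgH : g ∈ H := ⟨fun a ha => ha, hg⟩
  have hg2H : h * g * h⁻¹ ∈ H := by
    refine ⟨fun a ha => ?_, G.mul_mem (G.mul_mem hh hg) (G.inv_mem hh)⟩
    rw [Equiv.Perm.mul_apply, Equiv.Perm.mul_apply, hΓ' a ha, ← Equiv.Perm.mul_apply,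
      mul_inv_cancel, Equiv.Perm.one_apply]
  have hord : orderOf g = p := hc.orderOf
  have hfac : (Nat.card H).factorization p = 1 := by
    apply le_antisymm
    · have hd : Nat.card H ∣ p.factorial := by
        rw [← hKcard]; exact Subgroup.card_dvd_of_le inf_le_left
      have := (Nat.factorization_le_iff_dvd Nat.card_pos.ne' (Nat.factorial_ne_zero p)).2 hd p
      refine this.trans ?_
      rw [← Nat.mul_factorial_pred hp.ne_zero, Nat.factorization_mul hp.ne_zero
        (Nat.factorial_ne_zero _)]
      simp [hp.factorization_self, Nat.factorization_factorial_eq_zero_of_lt,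
        Nat.sub_lt hp.pos one_pos]
    · rw [← hp.dvd_iff_one_le_factorization Nat.card_pos.ne', ← hord,
        ← Subgroup.orderOf_mk g hgH]
      exact orderOf_dvd_natCard _
  obtain ⟨u, i, hu⟩ := jpc_sylow hp hfac ⟨g, hgH⟩ ⟨h * g * h⁻¹, hg2H⟩
    (by rw [Subgroup.orderOf_mk, hord])
    (by
      rw [Subgroup.orderOf_mk, ← hord]
      exact orderOf_injective (MulAut.conj h).toMonoidHom (MulAut.conj h).injective g)
  have hu' := congrArg Subtype.val hu
  simp only [Subgroup.coe_mul, Subgroup.coe_inv, Subgroup.coe_zpow] at hu'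
  refine ⟨u * h, G.mul_mem u.2.2 hh, fun a ha => ?_, i, ?_⟩
  · exact u.2.1 _ (hΓ a ha)
  · rw [← hu']; group

theorem jpc_three {Ω : Type*} [Fintype Ω] [DecidableEq Ω]
    (g : Equiv.Perm Ω) (hc : g.IsCycle) (c t : Equiv.Perm Ω)
    (hcomm : c * g = g * c) (ht : ∀ a, g a = a → c a = t a)
    (ht1 : ∀ a, g a ≠ a → t a = a) (ht2 : ∀ a, g a = a → g (t a) = t a) :
    ∃ i : ℤ, c = g ^ i * t := by
  obtain ⟨d, hd, hcyc⟩ := hc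
  have hcd : g (c d) ≠ c d := by
    intro h
    apply hd
    apply c.injective
    rw [← Equiv.Perm.mul_apply, hcomm]; exact h
  obtain ⟨i, hi⟩ := hcyc hcd
  refine ⟨i, Equiv.ext fun e => ?_⟩
  by_cases he : g e = e
  · rw [ht e he, Equiv.Perm.mul_apply, Equiv.Perm.zpow_apply_eq_self_of_apply_eq_self (ht2 e he)]
  · obtain ⟨j, hj⟩ := hcyc he
    have h1 : c * g ^ j = g ^ j * c := (show Commute c g from hcomm).zpow_right j
    rw [Equiv.Perm.mul_apply, ht1 e he, ← hj, ← Equiv.Perm.mul_apply, h1, Equiv.Perm.mul_apply,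
      ← hi, ← Equiv.Perm.mul_apply, ← Equiv.Perm.mul_apply, ← zpow_add, ← zpow_add, add_comm]

theorem jpc_trans {Ω : Type*} [Fintype Ω] [DecidableEq Ω]
    (G : Subgroup (Equiv.Perm Ω)) (hG : MulAction.IsPreprimitive G Ω)
    (g : Equiv.Perm Ω) (hg : g ∈ G) (hc : g.IsCycle)
    (hp : Nat.Prime g.support.card)
    (hfix : 3 ≤ g.supportᶜ.card) (s : Equiv.Perm Ω) :
    ∃ h ∈ G, ∀ a, g a = a → h a = s a := by
  classical
  obtain ⟨n, hn⟩ : ∃ n, g.supportᶜ.card = n + 1 := ⟨_, (Nat.sub_add_cancel (by omega)).symm⟩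
  have hcard : g.support.card + g.supportᶜ.card = Fintype.card Ω := Finset.card_add_card_compl _
  have hp2 := hp.two_le
  have hm : MulAction.IsMultiplyPreprimitive G Ω (n + 2) := by
    apply hG.isMultiplyPreprimitive (s := (g.support : Set Ω)ᶜ)
    · rw [← Finset.coe_compl, Set.ncard_coe_finset, hn]
    · rw [Nat.card_eq_fintype_card]; omega
    have := Equiv.Perm.isPretransitive_of_isCycle_mem hc hg
    apply MulAction.IsPreprimitive.of_prime_card
    convert! hp
    rw [Nat.card_eq_fintype_card, Fintype.card_subtype]
    apply congr_arg
    ext x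
    simp [SubMulAction.mem_ofFixingSubgroup_iff]
  have hm2 : MulAction.IsMultiplyPretransitive G Ω (n + 2) :=
    MulAction.IsMultiplyPreprimitive.isMultiplyPretransitive ..
  have hm3 : MulAction.IsMultiplyPretransitive G Ω (n + 1) :=
    MulAction.isMultiplyPretransitive_of_le' (n := n + 2) (by omega) (by
      rw [ENat.card_eq_coe_fintype_card]; norm_cast; omega)
  let e : Fin (n + 1) ≃ {a // a ∈ g.supportᶜ} := (Finset.equivFinOfCardEq hn).symm
  let x : Fin (n + 1) ↪ Ω := e.toEmbedding.trans (Function.Embedding.subtype _)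
  obtain ⟨h, hh⟩ := MulAction.exists_smul_eq G x (x.trans s.toEmbedding)
  refine ⟨h, h.2, fun a ha => ?_⟩
  have := DFunLike.congr_fun hh (e.symm ⟨a, by simpa using ha⟩)
  simpa [x, Function.Embedding.smul_apply, Subgroup.smul_def] using this

/-- **Jordan's theorem.** A primitive permutation group of finite degree containing a cycle
of prime length fixing at least three points contains the alternating group. -/
theorem jordan_prime_cycle (Ω : Type*) [Fintype Ω] [DecidableEq Ω]
    (G : Subgroup (Equiv.Perm Ω)) (hG : IsPreprimitive G Ω)
    (g : Equiv.Perm Ω) (hg : g ∈ G) (hc : g.IsCycle)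
    (hp : Nat.Prime g.support.card)
    (hfix : 3 ≤ g.supportᶜ.card) :
    alternatingGroup Ω ≤ G := by
  have hG' : MulAction.IsPreprimitive G Ω := by
    have := hG.1
    exact { isTrivialBlock_of_isBlock := fun {B} hB => hG.2 B hB }
  obtain ⟨a, b, c, ha, hb, hc', hab, hac, hbc⟩ := Finset.two_lt_card_iff.1 hfix
  have key : ∀ s : Equiv.Perm Ω, (∀ z, g z = z → g (s z) = s z) →
      ∃ x ∈ G, (∀ z, g z = z → x z = s z) ∧ ∃ i : ℤ, x * g * x⁻¹ = g ^ i := by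
    intro s hs
    obtain ⟨h, hh, hhs⟩ := jpc_trans G hG' g hg hc hp hfix s
    obtain ⟨x, hx, hxh, i, hi⟩ := jpc_normalizing G g hg hc hp h hh
      (fun z hz => by rw [hhs z hz]; exact hs z hz)
    exact ⟨x, hx, fun z hz => (hxh z hz).trans (hhs z hz), i, hi⟩
  simp only [Finset.mem_compl, Equiv.Perm.mem_support, not_not] at ha hb hc'
  have hsw : ∀ u v, g u = u → g v = v → ∀ z, g z = z →
      g (Equiv.swap u v z) = Equiv.swap u v z := by
    intro u v hu hv z hz
    rw [Equiv.swap_apply_def]; split_ifs <;> assumption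
  have hsw1 : ∀ u v, g u = u → g v = v → ∀ z, g z ≠ z → Equiv.swap u v z = z := by
    intro u v hu hv z hz
    apply Equiv.swap_apply_of_ne_of_ne <;> rintro rfl <;> contradiction
  obtain ⟨x, hx, hxs, i, hi⟩ := key (Equiv.swap a b) (hsw a b ha hb)
  obtain ⟨y, hy, hys, j, hj⟩ := key (Equiv.swap a c) (hsw a c ha hc')
  have hxi : ∀ z, g z = z → x⁻¹ z = Equiv.swap a b z := by
    intro z hz
    rw [Equiv.Perm.inv_eq_iff_eq, hxs _ (hsw a b ha hb z hz), Equiv.swap_apply_self]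
  have hyi : ∀ z, g z = z → y⁻¹ z = Equiv.swap a c z := by
    intro z hz
    rw [Equiv.Perm.inv_eq_iff_eq, hys _ (hsw a c ha hc' z hz), Equiv.swap_apply_self]
  set τ := Equiv.swap a b * Equiv.swap a c with hτ
  have h3 : τ.IsThreeCycle := Equiv.Perm.isThreeCycle_swap_mul_swap_same hab hac hbc
  have hxy : (x * y) * g * (x * y)⁻¹ = g ^ (j * i) := by
    have : (x * y) * g * (x * y)⁻¹ = x * (y * g * y⁻¹) * x⁻¹ := by group
    rw [this, hj, ← conj_zpow, hi, ← zpow_mul, mul_comm]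
  have hyx : (y * x) * g * (y * x)⁻¹ = g ^ (j * i) := by
    have : (y * x) * g * (y * x)⁻¹ = y * (x * g * x⁻¹) * y⁻¹ := by group
    rw [this, hi, ← conj_zpow, hj, ← zpow_mul]
  have hcomm : (x⁻¹ * y⁻¹ * x * y) * g = g * (x⁻¹ * y⁻¹ * x * y) := by
    have h := hxy.trans hyx.symm
    have h2 : (x⁻¹ * y⁻¹ * x * y) * g =
        (y * x)⁻¹ * ((x * y) * g * (x * y)⁻¹) * (x * y) := by group
    rw [h2, h]; group
  obtain ⟨k, hk⟩ := jpc_three g hc (x⁻¹ * y⁻¹ * x * y) (τ * τ) hcomm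
    (by
      intro z hz
      have h1 := hsw a c ha hc' z hz
      have h2 := hsw a b ha hb _ h1
      have h3 := hsw a c ha hc' _ h2
      simp only [Equiv.Perm.mul_apply, hτ]
      rw [hys z hz, hxs _ h1, hyi _ h2, hxi _ h3])
    (by
      intro z hz
      simp only [Equiv.Perm.mul_apply, hτ, hsw1 a b ha hb z hz, hsw1 a c ha hc' z hz])
    (by
      intro z hz
      simp only [Equiv.Perm.mul_apply, hτ]
      exact hsw a b ha hb _ (hsw a c ha hc' _ (hsw a b ha hb _ (hsw a c ha hc' _ hz))))
  have hmem : τ * τ ∈ G := by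
    have : τ * τ = (g ^ k)⁻¹ * (x⁻¹ * y⁻¹ * x * y) := by rw [hk]; group
    rw [this]
    exact G.mul_mem (G.inv_mem (G.zpow_mem hg k))
      (G.mul_mem (G.mul_mem (G.mul_mem (G.inv_mem hx) (G.inv_mem hy)) hx) hy)
  exact Equiv.Perm.alternatingGroup_le_of_isPreprimitive_of_isThreeCycle_mem hG'
    h3.isThreeCycle_sq hmem
end

section
/- Let n and k be positive integers with k coprime to n and k < n/2, and let G be a transitive permutation group of degree n containing a cycle of length n − k (a cycle with exactly k fixed points). Then G is primitive. -/
open Pointwise in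
/-- If `k` is coprime to `n` with `k < n/2`, then any transitive permutation group of
degree `n` containing a cycle of length `n - k` (a cycle fixing exactly `k` points)
is primitive. -/
theorem primitive_of_transitive_with_cycle (Ω : Type*) [Fintype Ω] [DecidableEq Ω]
    (n k : ℕ) (hn : Fintype.card Ω = n) (hk : 0 < k) (hcop : Nat.Coprime k n)
    (hlt : 2 * k < n)
    (G : Subgroup (Equiv.Perm Ω)) (htrans : MulAction.IsPretransitive G Ω)
    (g : Equiv.Perm Ω) (hg : g ∈ G) (hc : g.IsCycle)
    (hfix : g.supportᶜ.card = k) :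
    IsPreprimitive G Ω := by
  classical
  refine ⟨htrans, fun B hB => ?_⟩
  rcases B.eq_empty_or_nonempty with rfl | ⟨x0, hx0⟩
  · exact Or.inl Set.subsingleton_empty
  by_cases hmix : ∃ h : G, ∃ x ∈ h • B, ∃ y ∈ h • B, g x = x ∧ g y ≠ y
  · obtain ⟨h, x, hx, y, hy, hgx, hgy⟩ := hmix
    have hC : MulAction.IsBlock G (h • B) := hB.translate h
    have hsub : (g.support : Set Ω) ⊆ h • B := by
      intro z hz
      have hz' : g z ≠ z := by simpa using hz
      obtain ⟨i, hi⟩ := hc.exists_zpow_eq hgy hz'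
      have hfx : (g ^ i) x = x := Equiv.Perm.zpow_apply_eq_self_of_apply_eq_self hgx i
      have hmem : g ^ i ∈ G := G.zpow_mem hg i
      have e : (⟨g ^ i, hmem⟩ : G) • (h • B) = h • B := by
        apply hC.smul_eq_of_mem hx
        change (g ^ i) x ∈ h • B
        rwa [hfx]
      rw [← e]
      exact ⟨y, hy, hi⟩
    have hcard : g.support.card ≤ (h • B).ncard := by
      rw [← Set.ncard_coe_finset]
      exact Set.ncard_le_ncard hsub (Set.toFinite _)
    have hadd := Finset.card_add_card_compl g.support
    have huniv : h • B = Set.univ := by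
      apply hC.eq_univ_of_card_lt
      rw [Nat.card_eq_fintype_card]
      omega
    right
    have : B = h⁻¹ • (h • B) := by simp
    rw [this, huniv, Set.smul_set_univ]
  · left
    push Not at hmix
    choose t ht using fun x : Ω => MulAction.exists_smul_eq G x0 x
    let f : Ω → Set Ω := fun x => t x • B
    have hmem : ∀ x, x ∈ f x := fun x => ⟨x0, hx0, ht x⟩
    have hfib : ∀ x y, f y = f x ↔ y ∈ f x := by
      intro x y
      constructor
      · intro h; rw [← h]; exact hmem y
      · intro h
        exact MulAction.isBlock_iff_smul_eq_smul_of_nonempty.1 hB ⟨y, hmem y, h⟩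
    have hdvd : B.ncard ∣ k := by
      rw [← hfix, Finset.card_eq_sum_card_image f]
      apply Finset.dvd_sum
      intro C hCm
      obtain ⟨x, hx, rfl⟩ := Finset.mem_image.1 hCm
      have hx' : g x = x := by simpa using hx
      have : ((g.supportᶜ.filter (fun y => f y = f x) : Finset Ω) : Set Ω) = f x := by
        ext y
        simp only [Finset.coe_filter, Set.mem_setOf_eq, hfib]
        constructor
        · exact fun h => h.2
        · intro h
          refine ⟨?_, h⟩
          simpa using hmix (t x) x (hmem x) y h hx'
      rw [← Set.ncard_coe_finset, this]
      simp [f, Set.ncard_smul_set]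
    have hdn : B.ncard ∣ n := by
      have := hB.ncard_dvd_card ⟨x0, hx0⟩
      rwa [Nat.card_eq_fintype_card, hn] at this
    have h1 : B.ncard = 1 := Nat.eq_one_of_dvd_coprimes hcop hdvd hdn
    obtain ⟨a, rfl⟩ := Set.ncard_eq_one.1 h1
    exact Set.subsingleton_singleton
end
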